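/- For every ν ∈ ℤ^d \ {0}, the diagonal Gram matrix entry G_{νν} is real and satisfies the two-sided bound a₀² ≤ G_{νν} ≤ ‖a‖²_{H¹} + ρ²/(16π⁴) + a₀ρ/(2π²). -/

import Mathlib

open Finset MeasureTheory

noncomputable def fourF (d : ℕ) (ν : Fin d → ℤ) (x : Fin d → ℝ) : ℂ :=
  Complex.exp (2 * (Real.pi : ℂ) * Complex.I * ∑ j, (ν j : ℂ) * (x j : ℂ))

noncomputable def pdv (d : ℕ) (k : Fin d) (f : (Fin d → ℝ) → ℂ) : (Fin d → ℝ) → ℂ :=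
  fun x => fderiv ℝ f x (Pi.single k 1)

noncomputable def lapl (d : ℕ) (f : (Fin d → ℝ) → ℂ) : (Fin d → ℝ) → ℂ :=
  fun x => ∑ k, pdv d k (pdv d k f) x

noncomputable def sqL2 (d : ℕ) (f : (Fin d → ℝ) → ℂ) : ℝ :=
  ∫ x in Set.Icc (0 : Fin d → ℝ) 1, ‖f x‖ ^ 2

noncomputable def sqH2 (d : ℕ) (f : (Fin d → ℝ) → ℂ) : ℝ :=
  sqL2 d f + (∑ k : Fin d, sqL2 d (pdv d k f)) +
    ∑ k : Fin d, ∑ l : Fin d, sqL2 d (pdv d k (pdv d l f))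

noncomputable def enorm2Z (d : ℕ) (ν : Fin d → ℤ) : ℝ := ∑ j, ((ν j : ℝ)) ^ 2

noncomputable def dotZR (d : ℕ) (τ ν : Fin d → ℤ) : ℝ := ∑ j, (τ j : ℝ) * (ν j : ℝ)

noncomputable def Lop (d : ℕ) (a : (Fin d → ℝ) → ℂ) (ρ : ℝ) (u : (Fin d → ℝ) → ℂ) :
    (Fin d → ℝ) → ℂ :=
  fun x => -(∑ k, pdv d k (fun y => a y * pdv d k u y) x) + (ρ : ℂ) * u x

noncomputable def GramM (d : ℕ) (a : (Fin d → ℝ) → ℂ) (ρ : ℝ)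
    (Ψ : (Fin d → ℤ) → (Fin d → ℝ) → ℂ) (ν μ : Fin d → ℤ) : ℂ :=
  ∫ x in Set.Icc (0 : Fin d → ℝ) 1,
    Lop d a ρ (Ψ ν) x * (starRingEnd ℂ) (Lop d a ρ (Ψ μ) x)

theorem fourF_add (d : ℕ) (ν μ : Fin d → ℤ) (x : Fin d → ℝ) :
    fourF d (ν + μ) x = fourF d ν x * fourF d μ x := by
  simp only [fourF, ← Complex.exp_add, ← mul_add, ← Finset.sum_add_distrib, Pi.add_apply,
    Int.cast_add, add_mul]

theorem fourF_zero (d : ℕ) (x : Fin d → ℝ) : fourF d 0 x = 1 := by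
  simp [fourF]

theorem conj_fourF (d : ℕ) (ν : Fin d → ℤ) (x : Fin d → ℝ) :
    (starRingEnd ℂ) (fourF d ν x) = fourF d (-ν) x := by
  simp only [fourF, ← Complex.exp_conj]
  simp [map_sum, map_ofNat (starRingEnd ℂ) 2]

theorem fourF_eq_prod (d : ℕ) (ν : Fin d → ℤ) (x : Fin d → ℝ) :
    fourF d ν x = ∏ j, Complex.exp (2 * (Real.pi : ℂ) * Complex.I * (ν j : ℂ) * (x j : ℂ)) := by
  rw [fourF, Finset.mul_sum, Complex.exp_sum]
  simp only [mul_assoc]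

theorem hasFDerivAt_fourF (d : ℕ) (ν : Fin d → ℤ) (x : Fin d → ℝ) :
    HasFDerivAt (fourF d ν)
      (fourF d ν x • ((2 * (Real.pi : ℂ) * Complex.I) •
        ∑ j, (ν j : ℂ) • Complex.ofRealCLM.comp (ContinuousLinearMap.proj (R := ℝ) j))) x := by
  have h (j : Fin d) : HasFDerivAt (fun y : Fin d → ℝ => (ν j : ℂ) * (y j : ℂ))
      ((ν j : ℂ) • Complex.ofRealCLM.comp (ContinuousLinearMap.proj (R := ℝ) j)) x :=
    (Complex.ofRealCLM.comp (ContinuousLinearMap.proj (R := ℝ)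
      (φ := fun _ : Fin d => ℝ) j)).hasFDerivAt.const_mul (ν j : ℂ)
  exact ((HasFDerivAt.fun_sum fun j _ => h j).const_mul
    (2 * (Real.pi : ℂ) * Complex.I)).cexp

theorem differentiable_fourF (d : ℕ) (ν : Fin d → ℤ) : Differentiable ℝ (fourF d ν) :=
  fun x => (hasFDerivAt_fourF d ν x).differentiableAt

theorem pdv_fourF (d : ℕ) (k : Fin d) (ν : Fin d → ℤ) (x : Fin d → ℝ) :
    pdv d k (fourF d ν) x = 2 * (Real.pi : ℂ) * Complex.I * (ν k : ℂ) * fourF d ν x := by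
  rw [pdv, (hasFDerivAt_fourF d ν x).fderiv]
  simp [Pi.single_apply, apply_ite Complex.ofReal]
  ring

theorem pdv_sum_fourF {ι : Type*} (d : ℕ) (k : Fin d) (S : Finset ι) (c : ι → ℂ)
    (n : ι → Fin d → ℤ) (x : Fin d → ℝ) :
    pdv d k (fun y => ∑ i ∈ S, c i * fourF d (n i) y) x =
      ∑ i ∈ S, c i * (2 * (Real.pi : ℂ) * Complex.I * (n i k : ℂ) * fourF d (n i) x) := by
  rw [pdv, fderiv_fun_sum fun i _ => ((differentiable_fourF d (n i)) x).const_mul (c i),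
    _root_.sum_apply]
  refine Finset.sum_congr rfl fun i _ => ?_
  rw [fderiv_const_mul ((differentiable_fourF d (n i)) x), _root_.smul_apply,
    smul_eq_mul, ← pdv_fourF, pdv]

theorem pdv_const_mul_fourF (d : ℕ) (k : Fin d) (c : ℂ) (ν : Fin d → ℤ) (x : Fin d → ℝ) :
    pdv d k (fun y => c * fourF d ν y) x =
      c * (2 * (Real.pi : ℂ) * Complex.I * (ν k : ℂ) * fourF d ν x) := by
  simpa using pdv_sum_fourF d k {()} (fun _ => c) (fun _ => ν) x

theorem Lop_trigPoly_fourF (d : ℕ) (S : Finset (Fin d → ℤ)) (A : (Fin d → ℤ) → ℂ) (ρ : ℝ) (r : ℂ)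
    (ν : Fin d → ℤ) (x : Fin d → ℝ) :
    Lop d (fun y => ∑ τ ∈ S, A τ * fourF d τ y) ρ (fun y => r * fourF d ν y) x =
      (∑ τ ∈ S, r * (4 * (Real.pi : ℂ) ^ 2 * (dotZR d ν (τ + ν) : ℂ)) * A τ * fourF d (τ + ν) x)
        + ρ * (r * fourF d ν x) := by
  have h (k : Fin d) : (fun y => (∑ τ ∈ S, A τ * fourF d τ y) *
      pdv d k (fun y => r * fourF d ν y) y) =
      fun y => ∑ τ ∈ S, (A τ * r * (2 * (Real.pi : ℂ) * Complex.I * (ν k : ℂ))) *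
        fourF d (τ + ν) y := by
    funext y
    rw [pdv_const_mul_fourF, Finset.sum_mul]
    refine Finset.sum_congr rfl fun τ _ => ?_
    rw [fourF_add]
    ring
  simp only [Lop, h, pdv_sum_fourF]
  congr 1
  rw [Finset.sum_comm, ← Finset.sum_neg_distrib]
  refine Finset.sum_congr rfl fun τ _ => ?_
  simp only [dotZR, Complex.ofReal_sum, Finset.mul_sum, Finset.sum_mul, ← Finset.sum_neg_distrib]
  refine Finset.sum_congr rfl fun k _ => ?_
  push_cast
  linear_combination (-(A τ * r * 4 * (Real.pi : ℂ) ^ 2 * (ν k : ℂ) * ((τ + ν) k : ℂ) *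
    fourF d (τ + ν) x)) * Complex.I_sq

theorem integral_exp_two_pi_int (n : ℤ) :
    ∫ x in Set.Icc (0 : ℝ) 1, Complex.exp (2 * (Real.pi : ℂ) * Complex.I * (n : ℂ) * (x : ℂ)) =
      if n = 0 then 1 else 0 := by
  rw [integral_Icc_eq_integral_Ioc, ← intervalIntegral.integral_of_le zero_le_one]
  split_ifs with hn
  · simp [hn]
  · have hc : 2 * (Real.pi : ℂ) * Complex.I * (n : ℂ) ≠ 0 := by
      simp [hn, Real.pi_ne_zero]
    rw [integral_exp_mul_complex hc]
    have : 2 * (Real.pi : ℂ) * Complex.I * (n : ℂ) = n * (2 * Real.pi * Complex.I) := by ring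
    simp [this, Complex.exp_int_mul_two_pi_mul_I]

theorem integral_fourF (d : ℕ) (ν : Fin d → ℤ) :
    ∫ x in Set.Icc (0 : Fin d → ℝ) 1, fourF d ν x = if ν = 0 then 1 else 0 := by
  simp only [fourF_eq_prod]
  rw [← Set.pi_univ_Icc, volume_pi, Measure.restrict_pi_pi]
  rw [integral_fintype_prod_eq_prod (𝕜 := ℂ) (fun j (t : ℝ) =>
    Complex.exp (2 * (Real.pi : ℂ) * Complex.I * (ν j : ℂ) * (t : ℂ)))]
  simp only [Pi.zero_apply, Pi.one_apply, integral_exp_two_pi_int, Finset.prod_ite_zero,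
    Finset.prod_const_one, Finset.mem_univ, true_imp_iff, funext_iff]

theorem integrableOn_mul_fourF (d : ℕ) (c : ℂ) (ν : Fin d → ℤ) :
    IntegrableOn (fun x => c * fourF d ν x) (Set.Icc (0 : Fin d → ℝ) 1) :=
  ((differentiable_fourF d ν).continuous.const_mul c).continuousOn.integrableOn_compact
    isCompact_Icc

theorem integral_mul_conj_trigPoly (d : ℕ) (S : Finset (Fin d → ℤ)) (c : (Fin d → ℤ) → ℂ)
    (ν : Fin d → ℤ) :
    ∫ x in Set.Icc (0 : Fin d → ℝ) 1, (∑ τ ∈ S, c τ * fourF d (τ + ν) x) *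
      (starRingEnd ℂ) (∑ τ ∈ S, c τ * fourF d (τ + ν) x) =
      ((∑ τ ∈ S, ‖c τ‖ ^ 2 : ℝ) : ℂ) := by
  have h (x : Fin d → ℝ) : (∑ τ ∈ S, c τ * fourF d (τ + ν) x) *
      (starRingEnd ℂ) (∑ τ ∈ S, c τ * fourF d (τ + ν) x) =
      ∑ τ ∈ S, ∑ σ ∈ S, (c τ * (starRingEnd ℂ) (c σ)) * fourF d (τ - σ) x := by
    rw [map_sum, Finset.sum_mul_sum]
    refine Finset.sum_congr rfl fun τ _ => Finset.sum_congr rfl fun σ _ => ?_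
    rw [map_mul, conj_fourF, show τ - σ = (τ + ν) + -(σ + ν) by abel, fourF_add d (τ + ν)]
    ring
  simp only [h]
  rw [integral_finsetSum _ fun τ _ => integrable_finsetSum _ fun σ _ =>
    integrableOn_mul_fourF d _ _, Complex.ofReal_sum]
  refine Finset.sum_congr rfl fun τ hτ => ?_
  rw [integral_finsetSum _ fun σ _ => integrableOn_mul_fourF d _ _]
  simp only [integral_const_mul, integral_fourF, sub_eq_zero, mul_ite, mul_one, mul_zero,
    Finset.sum_ite_eq, hτ, if_true, Complex.mul_conj, Complex.normSq_eq_norm_sq]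

theorem dotZR_sq_le (d : ℕ) (τ ν : Fin d → ℤ) :
    dotZR d τ ν ^ 2 ≤ enorm2Z d τ * enorm2Z d ν :=
  Finset.sum_mul_sq_le_sq_mul_sq _ _ _

theorem enorm2Z_nonneg (d : ℕ) (ν : Fin d → ℤ) : 0 ≤ enorm2Z d ν :=
  Finset.sum_nonneg fun _ _ => sq_nonneg _

theorem one_le_enorm2Z (d : ℕ) {ν : Fin d → ℤ} (hν : ν ≠ 0) : 1 ≤ enorm2Z d ν := by
  obtain ⟨j, hj⟩ := Function.ne_iff.1 hν
  have h1 : (1 : ℝ) ≤ (ν j : ℝ) ^ 2 := by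
    exact_mod_cast Int.one_le_abs (pow_ne_zero 2 hj) |>.trans_eq (abs_of_nonneg (sq_nonneg _))
  exact h1.trans (Finset.single_le_sum (f := fun j => (ν j : ℝ) ^ 2)
    (fun _ _ => sq_nonneg _) (Finset.mem_univ j))

theorem dotZR_add_right (d : ℕ) (τ ν : Fin d → ℤ) :
    dotZR d ν (τ + ν) = dotZR d ν τ + enorm2Z d ν := by
  simp only [dotZR, enorm2Z, ← Finset.sum_add_distrib]
  refine Finset.sum_congr rfl fun j _ => ?_
  push_cast [Pi.add_apply]
  ring

theorem dotZR_add_sq_le (d : ℕ) {τ ν : Fin d → ℤ} (hτ : τ ≠ 0) (hν : ν ≠ 0) :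
    dotZR d ν (τ + ν) ^ 2 ≤ enorm2Z d ν ^ 2 * (1 + 4 * Real.pi ^ 2 * enorm2Z d τ) := by
  rw [dotZR_add_right]
  have hcs := dotZR_sq_le d ν τ
  have hn := one_le_enorm2Z d hν
  have ht := one_le_enorm2Z d hτ
  have hpi : 3 ≤ 4 * Real.pi ^ 2 := by nlinarith [Real.pi_gt_three]
  generalize dotZR d ν τ = p at *
  generalize enorm2Z d ν = n at *
  generalize enorm2Z d τ = t at *
  have hp : p ^ 2 ≤ n ^ 2 * t := by
    nlinarith [mul_nonneg (by linarith : 0 ≤ t) (by nlinarith : 0 ≤ n ^ 2 - n)]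
  have hpt : p ≤ n * t := by
    refine le_of_sq_le_sq ?_ (by positivity)
    nlinarith [mul_nonneg (sq_nonneg n) (by nlinarith : 0 ≤ t ^ 2 - t)]
  calc (p + n) ^ 2 ≤ n ^ 2 * (1 + 3 * t) := by nlinarith
    _ ≤ n ^ 2 * (1 + 4 * Real.pi ^ 2 * t) := by gcongr

theorem stmt4 (d : ℕ) (hd : 1 ≤ d)
    (T : Finset (Fin d → ℤ)) (hT0 : (0 : Fin d → ℤ) ∉ T) (hTsym : ∀ τ ∈ T, -τ ∈ T)
    (a₀ ρ : ℝ) (ha₀ : 0 < a₀) (hρ : 0 < ρ)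
    (aC : (Fin d → ℤ) → ℂ) (haSym : ∀ τ ∈ T, aC (-τ) = (starRingEnd ℂ) (aC τ))
    (a : (Fin d → ℝ) → ℂ) (ha : a = fun x => (a₀ : ℂ) + ∑ τ ∈ T, aC τ * fourF d τ x)
    (r : (Fin d → ℤ) → ℝ)
    (hr : r = fun ν => 1 / (4 * Real.pi ^ 2 * enorm2Z d ν + ρ / a₀))
    (Ψ : (Fin d → ℤ) → (Fin d → ℝ) → ℂ)
    (hΨ : Ψ = fun ν x => (r ν : ℂ) * fourF d ν x) :
    ∀ ν : Fin d → ℤ, ν ≠ 0 →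
      (GramM d a ρ Ψ ν ν).im = 0 ∧
      a₀ ^ 2 ≤ (GramM d a ρ Ψ ν ν).re ∧
      (GramM d a ρ Ψ ν ν).re ≤
        (a₀ ^ 2 + ∑ τ ∈ T, (1 + 4 * Real.pi ^ 2 * enorm2Z d τ) * ‖aC τ‖ ^ 2) +
          ρ ^ 2 / (16 * Real.pi ^ 4) + a₀ * ρ / (2 * Real.pi ^ 2) := by
  subst ha hr hΨ
  intro ν hν
  set r : ℝ := 1 / (4 * Real.pi ^ 2 * enorm2Z d ν + ρ / a₀) with hr
  set A : (Fin d → ℤ) → ℂ := fun τ => if τ = 0 then (a₀ : ℂ) else aC τ with hA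
  set c : (Fin d → ℤ) → ℂ := fun τ => if τ = 0 then (a₀ : ℂ) else
    r * (4 * (Real.pi : ℂ) ^ 2 * (dotZR d ν (τ + ν) : ℂ)) * aC τ with hc
  have hn := one_le_enorm2Z d hν
  have hD : 0 < 4 * Real.pi ^ 2 * enorm2Z d ν + ρ / a₀ := by positivity
  have hT (τ) (hτ : τ ∈ T) : τ ≠ 0 := fun h => hT0 (h ▸ hτ)
  have ha : (fun x => (a₀ : ℂ) + ∑ τ ∈ T, aC τ * fourF d τ x) =
      fun x => ∑ τ ∈ insert 0 T, A τ * fourF d τ x := by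
    funext x
    rw [Finset.sum_insert hT0, fourF_zero, mul_one]
    congr 1
    · simp [hA]
    · exact Finset.sum_congr rfl fun τ hτ => by simp [hA, hT τ hτ]
  have hL (x : Fin d → ℝ) : Lop d (fun x => (a₀ : ℂ) + ∑ τ ∈ T, aC τ * fourF d τ x) ρ
      (fun x => (r : ℂ) * fourF d ν x) x = ∑ τ ∈ insert 0 T, c τ * fourF d (τ + ν) x := by
    rw [ha, Lop_trigPoly_fourF, Finset.sum_insert hT0, Finset.sum_insert hT0,
      Finset.sum_congr rfl fun τ hτ => show _ = c τ * fourF d (τ + ν) x by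
        simp [hA, hc, hT τ hτ]]
    have hr0 : r * (4 * Real.pi ^ 2 * enorm2Z d ν * a₀ + ρ) = a₀ := by
      rw [hr]
      field_simp
    have hr0' : (r : ℂ) * (4 * (Real.pi : ℂ) ^ 2 * (enorm2Z d ν : ℂ) * a₀ + ρ) = a₀ := by
      exact_mod_cast hr0
    have hdot : dotZR d ν (0 + ν) = enorm2Z d ν := by
      simp [dotZR, enorm2Z, sq]
    rw [hdot, zero_add]
    simp only [hA, hc, if_true]
    linear_combination fourF d ν x * hr0'
  have hG : GramM d (fun x => (a₀ : ℂ) + ∑ τ ∈ T, aC τ * fourF d τ x) ρ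
      (fun ν x => ((1 / (4 * Real.pi ^ 2 * enorm2Z d ν + ρ / a₀) : ℝ) : ℂ) * fourF d ν x) ν ν =
      ((∑ τ ∈ insert 0 T, ‖c τ‖ ^ 2 : ℝ) : ℂ) := by
    simp only [GramM, ← hr, hL]
    exact integral_mul_conj_trigPoly d _ c ν
  have hc0 : ‖c 0‖ ^ 2 = a₀ ^ 2 := by simp [hc]
  rw [hG, Complex.ofReal_im, Complex.ofReal_re, Finset.sum_insert hT0, hc0]
  refine ⟨rfl, le_add_of_nonneg_right (Finset.sum_nonneg fun _ _ => sq_nonneg _), ?_⟩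
  have hcT (τ) (hτ : τ ∈ T) :
      ‖c τ‖ ^ 2 ≤ (1 + 4 * Real.pi ^ 2 * enorm2Z d τ) * ‖aC τ‖ ^ 2 := by
    have hcτ : ‖c τ‖ ^ 2 = (r * (4 * Real.pi ^ 2)) ^ 2 * dotZR d ν (τ + ν) ^ 2 * ‖aC τ‖ ^ 2 := by
      simp [hc, hT τ hτ, mul_pow, mul_assoc]
    have hrn : r * (4 * Real.pi ^ 2) * enorm2Z d ν ≤ 1 := by
      rw [hr, mul_assoc, one_div_mul_eq_div, div_le_one hD]
      exact le_add_of_nonneg_right (by positivity)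
    have ht := enorm2Z_nonneg d τ
    rw [hcτ]
    gcongr
    calc (r * (4 * Real.pi ^ 2)) ^ 2 * dotZR d ν (τ + ν) ^ 2
        ≤ (r * (4 * Real.pi ^ 2)) ^ 2 *
            (enorm2Z d ν ^ 2 * (1 + 4 * Real.pi ^ 2 * enorm2Z d τ)) := by
          gcongr
          exact dotZR_add_sq_le d (hT τ hτ) hν
      _ = (r * (4 * Real.pi ^ 2) * enorm2Z d ν) ^ 2 * (1 + 4 * Real.pi ^ 2 * enorm2Z d τ) := by
          ring
      _ ≤ 1 * (1 + 4 * Real.pi ^ 2 * enorm2Z d τ) := by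
          gcongr
          exact pow_le_one₀ (by positivity) hrn
      _ = _ := one_mul _
  have hsum := Finset.sum_le_sum hcT
  have h1 : 0 ≤ ρ ^ 2 / (16 * Real.pi ^ 4) := by positivity
  have h2 : 0 ≤ a₀ * ρ / (2 * Real.pi ^ 2) := by positivity
  linarith
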